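/- Every cograph G with at least two vertices has a pair of siblings: there exist distinct vertices u and v such that N(u) = N(v) (duplicates) or N[u] = N[v] (coduplicates). -/

import Mathlib

/-- A cograph is a finite simple graph with no induced path on four vertices. -/
def IsCograph {V : Type*} (G : SimpleGraph V) : Prop :=
  ¬ Nonempty (SimpleGraph.pathGraph 4 ↪g G)

def NP4 {V : Type*} (G : SimpleGraph V) : Prop :=
  ∀ a b c d, G.Adj a b → G.Adj b c → G.Adj c d → a ≠ c → a ≠ d → b ≠ d →
    ¬ G.Adj a c → ¬ G.Adj a d → ¬ G.Adj b d → False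

def Split {V : Type*} (G : SimpleGraph V) (S : Set V) : Prop :=
  ∃ A B : Set V, A ∪ B = S ∧ Disjoint A B ∧ A.Nonempty ∧ B.Nonempty ∧
    ∀ a ∈ A, ∀ b ∈ B, ¬ G.Adj a b

theorem NP4.compl {V : Type*} {G : SimpleGraph V} (h : NP4 G) : NP4 Gᶜ := by
  intro a b c d hab hbc hcd hac had hbd nac nad nbd
  simp only [SimpleGraph.compl_adj, not_and, not_not] at *
  exact h b d a c (nbd hbd) (nad had).symm (nac hac) hab.1.symm hbc.1 hcd.1.symm
    (fun h => hab.2 h.symm) hbc.2 (fun h => hcd.2 h.symm)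

theorem split_step {V : Type*} {G : SimpleGraph V} (h : NP4 G) (S : Set V) (x : V) (hx : x ∉ S)
    (hS : Split G S) : Split G (insert x S) ∨ Split Gᶜ (insert x S) := by
  classical
  by_cases hall : ∀ y ∈ S, G.Adj x y
  · right
    refine ⟨{x}, S, rfl, by simpa using hx, by simp, ?_, ?_⟩
    · obtain ⟨A, B, rfl, -, ⟨a, ha⟩, -⟩ := hS
      exact ⟨a, Or.inl ha⟩
    · rintro a rfl b hb
      simp [hall b hb]
  left
  push Not at hall
  obtain ⟨y, hyS, hxy⟩ := hall
  have key : ∀ A B : Set V, A ∪ B = S → Disjoint A B → B.Nonempty →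
      (∀ a ∈ A, ∀ b ∈ B, ¬ G.Adj a b) → y ∈ A → Split G (insert x S) := by
    rintro A B rfl hd hB hn hyA
    by_cases hc : ∃ c ∈ B, G.Adj x c
    swap
    · push Not at hc
      refine ⟨insert x A, B, by rw [Set.insert_union], ?_, by simp, hB, ?_⟩
      · rw [Set.disjoint_insert_left]
        exact ⟨fun h => hx (Or.inr h), hd⟩
      · rintro a (rfl | ha) b hb
        · exact hc b hb
        · exact hn a ha b hb
    obtain ⟨c, hcB, hxc⟩ := hc
    let R : Set V := {w | Relation.ReflTransGen (fun a b => G.Adj a b ∧ b ∈ A) y w}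
    have hRA : R ⊆ A := by
      intro w hw
      rcases Relation.ReflTransGen.cases_tail hw with h | ⟨_, _, h⟩
      · exact h ▸ hyA
      · exact h.2
    have hRx : ∀ w ∈ R, ¬ G.Adj x w := by
      intro w hw
      induction hw with
      | refl => exact hxy
      | @tail b a hb hab ih =>
        intro hxa
        have hbA : b ∈ A := hRA hb
        have haA := hab.2
        refine h c x a b hxc.symm hxa hab.1.symm ?_ ?_ ?_ ?_ ?_ ih
        · rintro rfl; exact Set.disjoint_left.1 hd haA hcB
        · rintro rfl; exact Set.disjoint_left.1 hd hbA hcB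
        · rintro rfl; exact hx (Or.inl hbA)
        · intro h; exact hn _ haA _ hcB h.symm
        · intro h; exact hn _ hbA _ hcB h.symm
    refine ⟨R, insert x (A ∪ B) \ R, ?_, Set.disjoint_sdiff_right, ⟨y, .refl⟩, ⟨x, by simp, ?_⟩, ?_⟩
    · rw [Set.union_sdiff_cancel]
      exact fun w hw => Or.inr (Or.inl (hRA hw))
    · exact fun h => hx (Or.inl (hRA h))
    · rintro a ha b ⟨hb | hb | hb, hbR⟩ hab
      · subst hb; exact hRx a ha hab.symm
      · exact hbR (Relation.ReflTransGen.tail ha ⟨hab, hb⟩)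
      · exact hn a (hRA ha) b hb hab
  obtain ⟨A, B, hu, hd, hA, hB, hn⟩ := hS
  rw [← hu] at hyS
  rcases hyS with hy | hy
  · exact key A B hu hd hB hn hy
  · exact key B A (by rw [Set.union_comm, hu]) hd.symm hA
      (fun a ha b hb h => hn b hb a ha h.symm) hy

theorem split_all {V : Type*} {G : SimpleGraph V} (h : NP4 G) (S : Set V) (hf : S.Finite) :
    S.Nontrivial → Split G S ∨ Split Gᶜ S := by
  induction S, hf using Set.Finite.induction_on with
  | empty => simp
  | @insert x S hx _ ih =>
    intro hnt
    by_cases hS : S.Nontrivial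
    · rcases ih hS with h1 | h1
      · exact split_step h S x hx h1
      · have := split_step h.compl S x hx h1
        rw [compl_compl] at this
        exact this.symm
    · rw [Set.not_nontrivial_iff] at hS
      rcases hS.eq_empty_or_singleton with rfl | ⟨y, rfl⟩
      · simp at hnt
      · have hxy : x ≠ y := by simpa using hx
        by_cases ha : G.Adj x y
        · exact .inr ⟨{x}, {y}, rfl, by simpa using hxy, by simp, by simp, by simp [ha]⟩
        · exact .inl ⟨{x}, {y}, rfl, by simpa using hxy, by simp, by simp, by simp [ha]⟩

def IsMod {V : Type*} (G : SimpleGraph V) (M : Set V) : Prop :=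
  ∀ x, x ∉ M → ∀ a ∈ M, ∀ b ∈ M, G.Adj x a → G.Adj x b

theorem IsMod.compl {V : Type*} {G : SimpleGraph V} {M : Set V} (h : IsMod G M) : IsMod Gᶜ M := by
  intro x hx a ha b hb hab
  rw [SimpleGraph.compl_adj] at *
  exact ⟨fun e => hx (e ▸ hb), fun h' => hab.2 (h x hx b hb a ha h')⟩

theorem mod_step {V : Type*} [Finite V] {G : SimpleGraph V} {M : Set V} (h : IsMod G M)
    (hs : Split G M) : (∃ u v, u ≠ v ∧ M = {u, v}) ∨ ∃ M', M'.ncard < M.ncard ∧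
      M'.Nontrivial ∧ IsMod G M' := by
  have key : ∀ A B : Set V, A ∪ B = M → Disjoint A B → B.Nonempty →
      (∀ a ∈ A, ∀ b ∈ B, ¬ G.Adj a b) → A.Nontrivial → ∃ M', M'.ncard < M.ncard ∧
      M'.Nontrivial ∧ IsMod G M' := by
    rintro A B rfl hd ⟨b, hb⟩ hn hA
    refine ⟨A, Set.ncard_lt_ncard ⟨Set.subset_union_left, fun hh => ?_⟩ (Set.toFinite _), hA, ?_⟩
    · exact Set.disjoint_left.1 hd (hh (Or.inr hb)) hb
    · intro x hx a ha a' ha' hadj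
      by_cases hxB : x ∈ B
      · exact absurd hadj.symm (hn a ha x hxB)
      · exact h x (by rintro (h | h) <;> contradiction) a (.inl ha) a' (.inl ha') hadj
  obtain ⟨A, B, hu, hd, hA, hB, hn⟩ := hs
  by_cases hA' : A.Nontrivial
  · exact .inr (key A B hu hd hB hn hA')
  by_cases hB' : B.Nontrivial
  · exact .inr (key B A (by rw [Set.union_comm, hu]) hd.symm hA
      (fun a ha b hb h => hn b hb a ha h.symm) hB')
  rw [Set.not_nontrivial_iff] at hA' hB'
  left
  obtain ⟨u, hu'⟩ := hA
  obtain ⟨v, hv'⟩ := hB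
  have e1 := hA'.eq_singleton_of_mem hu'
  have e2 := hB'.eq_singleton_of_mem hv'
  refine ⟨u, v, ?_, ?_⟩
  · rintro rfl; exact Set.disjoint_left.1 hd hu' hv'
  · rw [← hu, e1, e2]; rfl

theorem mod_twins {V : Type*} [Finite V] {G : SimpleGraph V} (h : NP4 G) (n : ℕ) :
    ∀ M : Set V, M.ncard = n → M.Nontrivial → IsMod G M →
      ∃ u v, u ≠ v ∧ IsMod G {u, v} := by
  induction n using Nat.strong_induction_on with
  | _ n ih =>
    rintro M rfl hnt hM
    rcases split_all h M (Set.toFinite _) hnt with hs | hs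
    · rcases mod_step hM hs with ⟨u, v, huv, rfl⟩ | ⟨M', h1, h2, h3⟩
      · exact ⟨u, v, huv, hM⟩
      · exact ih _ h1 M' rfl h2 h3
    · rcases mod_step hM.compl hs with ⟨u, v, huv, rfl⟩ | ⟨M', h1, h2, h3⟩
      · exact ⟨u, v, huv, hM⟩
      · exact ih _ h1 M' rfl h2 (by simpa using h3.compl)

theorem IsCograph.np4 {V : Type*} {G : SimpleGraph V} (h : IsCograph G) : NP4 G := by
  intro a b c d hab hbc hcd hac had hbd nac nad nbd
  apply h
  have e1 := hab.ne
  have e2 := hbc.ne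
  have e3 := hcd.ne
  refine ⟨⟨⟨![a, b, c, d], ?_⟩, ?_⟩⟩
  · intro i j hij
    fin_cases i <;> fin_cases j <;> simp_all
  · intro i j
    have := hab.symm
    have := hbc.symm
    have := hcd.symm
    have : ¬ G.Adj c a := fun h => nac h.symm
    have : ¬ G.Adj d a := fun h => nad h.symm
    have : ¬ G.Adj d b := fun h => nbd h.symm
    fin_cases i <;> fin_cases j <;> simp_all [SimpleGraph.pathGraph_adj] <;> assumption

/-- Every cograph with at least two vertices has a pair of siblings: distinct vertices
`u`, `v` with `N(u) = N(v)` (duplicates) or `N[u] = N[v]` (coduplicates). -/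
theorem cograph_has_siblings {V : Type*} [Fintype V] (G : SimpleGraph V)
    (hG : IsCograph G) (h2 : 2 ≤ Fintype.card V) :
    ∃ u v : V, u ≠ v ∧
      (G.neighborSet u = G.neighborSet v ∨
        insert u (G.neighborSet u) = insert v (G.neighborSet v)) := by
  have : Nontrivial V := Fintype.one_lt_card_iff_nontrivial.1 h2
  obtain ⟨u, v, huv, hm⟩ := mod_twins hG.np4 _ Set.univ rfl Set.nontrivial_univ
    (fun x hx => absurd (Set.mem_univ x) hx)
  have hm' : ∀ w, w ≠ u → w ≠ v → (G.Adj u w ↔ G.Adj v w) := by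
    intro w h1 h2
    have hw : w ∉ ({u, v} : Set V) := by simp [h1, h2]
    rw [G.adj_comm u, G.adj_comm v]
    exact ⟨hm w hw u (by simp) v (by simp), hm w hw v (by simp) u (by simp)⟩
  refine ⟨u, v, huv, ?_⟩
  by_cases ha : G.Adj u v
  · right
    ext w
    have := ha.symm
    by_cases h1 : w = u
    · subst h1; simp [this]
    by_cases h2 : w = v
    · subst h2; simp [ha]
    simp [h1, h2, hm' w h1 h2]
  · left
    ext w
    have : ¬ G.Adj v u := fun h => ha h.symm
    by_cases h1 : w = u
    · subst h1; simp [this]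
    by_cases h2 : w = v
    · subst h2; simp [ha]
    simp [hm' w h1 h2]
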